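/- Let p be a prime, n ≥ 2, and F a field containing a primitive p-th root of unity ζ, with a fixed algebraic closure Ω. Let K/F be a finite Galois extension inside Ω equipped with a group isomorphism e : Gal(K/F) ≅ U_n(F_p), compatible with a₁, …, a_{n−1} ∈ F^×. Let a_n ∈ F^× and w ∈ K^× with N_{K/F}(w) = a_n, and assume a₁, …, a_n are linearly independent in F^×/(F^×)^p. Let L be the subfield of Ω generated over K by all elements x ∈ Ω with x^p = σ(w) for some σ ∈ Gal(K/F). Then L/F is a finite Galois extension and Gal(L/F) is isomorphic to the semidirect product F_p[U_n(F_p)] ⋊ U_n(F_p), where F_p[U_n(F_p)] is the additive group of all functions U_n(F_p) → F_p and U_n(F_p) acts by left translation of the argument: (g·f)(x) = f(g⁻¹x). -/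

import Mathlib

/-- `g` is an upper unitriangular matrix. -/
def IsUni {n : ℕ} {R : Type*} [CommRing R] (g : Matrix (Fin n) (Fin n) R) : Prop :=
  (∀ i, g i i = 1) ∧ ∀ i j : Fin n, (j : ℕ) < (i : ℕ) → g i j = 0

theorem isUni_one {n : ℕ} {R : Type*} [CommRing R] :
    IsUni (1 : Matrix (Fin n) (Fin n) R) :=
  ⟨fun i => Matrix.one_apply_eq i,
   fun i j hij => Matrix.one_apply_ne (by rintro rfl; exact absurd hij (lt_irrefl _))⟩

theorem isUni_mul {n : ℕ} {R : Type*} [CommRing R] {A B : Matrix (Fin n) (Fin n) R}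
    (hA : IsUni A) (hB : IsUni B) : IsUni (A * B) := by
  constructor
  · intro i
    rw [Matrix.mul_apply, Finset.sum_eq_single i]
    · rw [hA.1 i, hB.1 i, one_mul]
    · intro k _ hk
      have hk' : (k : ℕ) ≠ (i : ℕ) := fun h => hk (Fin.ext h)
      rcases Nat.lt_or_ge (k : ℕ) (i : ℕ) with h | h
      · rw [hA.2 i k h, zero_mul]
      · rw [hB.2 k i (by omega), mul_zero]
    · intro hi; exact absurd (Finset.mem_univ i) hi
  · intro i j hij
    rw [Matrix.mul_apply]
    refine Finset.sum_eq_zero fun k _ => ?_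
    rcases Nat.lt_or_ge (k : ℕ) (i : ℕ) with h | h
    · rw [hA.2 i k h, zero_mul]
    · rw [hB.2 k j (by omega), mul_zero]

/-- The group `U_n(F_p)` of upper unitriangular `n × n` matrices over `F_p`, realized as a
subgroup of the units of the matrix ring. -/
def Uni (n p : ℕ) [NeZero p] : Subgroup (Matrix (Fin n) (Fin n) (ZMod p))ˣ where
  carrier := {g | IsUni (g : Matrix (Fin n) (Fin n) (ZMod p))}
  one_mem' := by simpa using isUni_one
  mul_mem' {a b} ha hb := by simpa [Units.val_mul] using isUni_mul ha hb
  inv_mem' {g} hg := by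
    have hpow : ∀ k : ℕ, IsUni ((↑(g ^ k) : Matrix (Fin n) (Fin n) (ZMod p))) := by
      intro k
      induction k with
      | zero => simpa using isUni_one
      | succ k ih => rw [pow_succ, Units.val_mul]; exact isUni_mul ih hg
    have h1 : g ^ (orderOf g - 1) * g = 1 := by
      rw [← pow_succ, Nat.sub_add_cancel (orderOf_pos g), pow_orderOf_eq_one]
    have h2 : g⁻¹ = g ^ (orderOf g - 1) := inv_eq_of_mul_eq_one_left h1
    show IsUni ((↑(g⁻¹) : Matrix (Fin n) (Fin n) (ZMod p)))
    rw [h2]; exact hpow _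

/-- The `(i, j)` entry of an element of `U_n(F_p)`. -/
def entry {n p : ℕ} [NeZero p] (g : ↥(Uni n p)) (i j : Fin n) : ZMod p :=
  ((g : (Matrix (Fin n) (Fin n) (ZMod p))ˣ) : Matrix (Fin n) (Fin n) (ZMod p)) i j

/-- The wreath-type semidirect product `F_p[G] ⋊ G`: pairs `(f, g)` with `f : G → F_p`
and `g : G`, where `G` acts on functions by left translation of the argument:
`(g·f)(x) = f(g⁻¹x)`; the multiplication is `(f, g)·(f', g') = (f + g·f', gg')`. -/
structure WrG (G : Type*) (p : ℕ) where
  base : G → ZMod p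
  top : G

instance WrG.instGroup (G : Type*) [Group G] (p : ℕ) : Group (WrG G p) where
  mul x y := ⟨x.base + fun k => y.base (x.top⁻¹ * k), x.top * y.top⟩
  one := ⟨0, 1⟩
  inv x := ⟨fun k => -x.base (x.top * k), x.top⁻¹⟩
  mul_assoc a b c := by
    show WrG.mk _ _ = WrG.mk _ _
    simp only [WrG.mk.injEq]
    constructor
    · funext k
      show a.base k + b.base (a.top⁻¹ * k) + c.base ((a.top * b.top)⁻¹ * k) =
        a.base k + (b.base (a.top⁻¹ * k) + c.base (b.top⁻¹ * (a.top⁻¹ * k)))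
      rw [add_assoc, mul_inv_rev, mul_assoc]
    · exact mul_assoc _ _ _
  one_mul a := by
    show WrG.mk _ _ = a
    cases a with
    | mk f s =>
      simp only [WrG.mk.injEq]
      constructor
      · funext k
        show 0 + f ((1 : G)⁻¹ * k) = f k
        rw [inv_one, one_mul, zero_add]
      · exact one_mul s
  mul_one a := by
    show WrG.mk _ _ = a
    cases a with
    | mk f s =>
      simp only [WrG.mk.injEq]
      constructor
      · funext k
        show f k + 0 = f k
        rw [add_zero]
      · exact mul_one s
  inv_mul_cancel a := by
    show WrG.mk _ _ = WrG.mk _ _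
    simp only [WrG.mk.injEq]
    constructor
    · funext k
      show -a.base (a.top * k) + a.base ((a.top⁻¹)⁻¹ * k) = 0
      rw [inv_inv, neg_add_cancel]
    · exact inv_mul_cancel a.top

open IntermediateField

namespace S14

/-- Elementary unitriangular matrix. -/
def E {n p : ℕ} [NeZero p] (i j : Fin n) (h : i < j) (t : ZMod p) : ↥(Uni n p) :=
  ⟨⟨Matrix.transvection i j t, Matrix.transvection i j (-t),
    by rw [Matrix.transvection_mul_transvection_same _ _ h.ne]; simp,
    by rw [Matrix.transvection_mul_transvection_same _ _ h.ne]; simp⟩, by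
    constructor
    · intro k
      have : ¬ (i = k ∧ j = k) := by rintro ⟨rfl, rfl⟩; exact lt_irrefl _ h
      simp [Matrix.transvection, Matrix.single_apply, this]
    · intro a b hab
      have h1 : ¬ (i = a ∧ j = b) := by rintro ⟨rfl, rfl⟩; exact lt_asymm h (Fin.lt_def.2 hab)
      have h2 : a ≠ b := by rintro rfl; omega
      simp [Matrix.transvection, Matrix.single_apply, h1, h2]⟩

theorem ext_entry {n p : ℕ} [NeZero p] {g h : ↥(Uni n p)}
    (H : ∀ i j, entry g i j = entry h i j) : g = h := by
  apply Subtype.ext; apply Units.ext; ext i j; exact H i j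

theorem entry_mul {n p : ℕ} [NeZero p] (g h : ↥(Uni n p)) (i j : Fin n) :
    entry (g * h) i j = ∑ k, entry g i k * entry h k j := by
  simp [entry, Matrix.mul_apply]

theorem entry_diag {n p : ℕ} [NeZero p] (g : ↥(Uni n p)) (i : Fin n) : entry g i i = 1 :=
  g.2.1 i

theorem entry_low {n p : ℕ} [NeZero p] (g : ↥(Uni n p)) (i j : Fin n) (h : j < i) :
    entry g i j = 0 := g.2.2 i j h

theorem entry_one {n p : ℕ} [NeZero p] (i j : Fin n) :
    entry (1 : ↥(Uni n p)) i j = if i = j then 1 else 0 := by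
  simp [entry, Matrix.one_apply]

theorem entry_E {n p : ℕ} [NeZero p] (i j : Fin n) (h : i < j) (t : ZMod p) (a b : Fin n) :
    entry (E i j h t) a b = (if a = b then 1 else 0) + (if i = a ∧ j = b then t else 0) := by
  simp [entry, E, Matrix.transvection, Matrix.single_apply, Matrix.one_apply]

theorem entry_E_mul {n p : ℕ} [NeZero p] (i j : Fin n) (h : i < j) (t : ZMod p) (g : ↥(Uni n p))
    (a b : Fin n) :
    entry (E i j h t * g) a b = entry g a b + (if i = a then t * entry g j b else 0) := by
  rw [entry_mul]
  simp only [entry_E, add_mul, Finset.sum_add_distrib]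
  congr 1
  · simp
  · by_cases hi : i = a <;> simp [hi]

theorem E_add {n p : ℕ} [NeZero p] (i j : Fin n) (h : i < j) (s t : ZMod p) :
    E i j h (s + t) = E i j h s * E i j h t := by
  apply Subtype.ext; apply Units.ext
  exact (Matrix.transvection_mul_transvection_same _ _ h.ne s t).symm

theorem E_comm {n p : ℕ} [NeZero p] (i k j : Fin n) (h : i < k) (h' : k < j) (t : ZMod p) :
    E i k h t * E k j h' 1 = E i j (h.trans h') t * (E k j h' 1 * E i k h t) := by
  apply ext_entry
  intro a b
  simp only [entry_E_mul, entry_E]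
  have := h.ne; have := h'.ne; have := (h.trans h').ne
  have := h.ne'; have := h'.ne'; have := (h.trans h').ne'
  by_cases h1 : i = a <;> by_cases h2 : k = a <;> by_cases h3 : j = b <;> by_cases h4 : k = b <;>
   (try subst h1) <;> (try subst h2) <;> (try subst h3) <;> (try subst h4) <;> simp_all

theorem super_add {n p : ℕ} [NeZero p] (i : ℕ) (hi : i + 1 < n) (g h : ↥(Uni n p)) :
    entry (g * h) ⟨i, Nat.lt_of_succ_lt hi⟩ ⟨i + 1, hi⟩ =
      entry g ⟨i, Nat.lt_of_succ_lt hi⟩ ⟨i + 1, hi⟩ + entry h ⟨i, Nat.lt_of_succ_lt hi⟩ ⟨i + 1, hi⟩ := by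
  rw [entry_mul, Fintype.sum_eq_add (⟨i, Nat.lt_of_succ_lt hi⟩ : Fin n) ⟨i + 1, hi⟩ (by simp)]
  · simp [entry_diag, add_comm]
  · rintro ⟨k, hk⟩ ⟨h1, h2⟩
    simp only [ne_eq, Fin.mk.injEq] at h1 h2
    rcases Nat.lt_or_ge k i with h | h
    · rw [entry_low g _ _ (by simpa using h), zero_mul]
    · rw [entry_low _ ⟨k, hk⟩ _ (by simp; omega), mul_zero]

/-- Superdiagonal entry, as a total function. -/
def sd {n p : ℕ} [NeZero p] (i : ℕ) (g : ↥(Uni n p)) : ZMod p :=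
  if hi : i + 1 < n then entry g ⟨i, Nat.lt_of_succ_lt hi⟩ ⟨i + 1, hi⟩ else 0

theorem sd_mul {n p : ℕ} [NeZero p] (i : ℕ) (g h : ↥(Uni n p)) :
    sd i (g * h) = sd i g + sd i h := by
  unfold sd
  split_ifs with hi
  · exact super_add i hi g h
  · simp

theorem gen {n p : ℕ} [NeZero p] (ψ : ↥(Uni n p) → ZMod p)
    (hψ : ∀ g h, ψ (g * h) = ψ g + ψ h) (hE : ∀ i j h t, ψ (E i j h t) = 0) :
    ∀ (m : ℕ) (g : ↥(Uni n p)),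
      (Finset.univ.filter fun x : Fin n × Fin n => x.1 < x.2 ∧ entry g x.1 x.2 ≠ 0).card = m →
      ψ g = 0 := by
  have h1 : ψ 1 = 0 := by simpa using hψ 1 1
  intro m
  induction m with
  | zero =>
    intro g hg
    have : g = 1 := by
      apply ext_entry
      intro i j
      rw [entry_one]
      rcases lt_trichotomy i j with h | h | h
      · rw [Finset.card_eq_zero, Finset.filter_eq_empty_iff] at hg
        have := hg (Finset.mem_univ (i, j))
        simp only [not_and, not_not] at this
        rw [this h, if_neg h.ne]
      · subst h; simp [entry_diag]
      · rw [entry_low _ _ _ h, if_neg h.ne']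
    rw [this, h1]
  | succ m ih =>
    intro g hg
    have hne : (Finset.univ.filter fun x : Fin n × Fin n => x.1 < x.2 ∧ entry g x.1 x.2 ≠ 0).Nonempty := by
      rw [← Finset.card_pos]; omega
    obtain ⟨⟨i, j⟩, hij, hmax⟩ := Finset.exists_max_image _ (fun x => x.1) hne
    simp only [Finset.mem_filter, Finset.mem_univ, true_and, and_imp, Prod.forall] at hij hmax
    have hrow : ∀ b, entry g j b = if j = b then 1 else 0 := by
      intro b
      rcases lt_trichotomy j b with h | h | h
      · rw [if_neg h.ne]
        by_contra h0
        exact absurd (hmax j b h h0) (not_le.2 hij.1)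
      · subst h; simp [entry_diag]
      · rw [entry_low _ _ _ h, if_neg h.ne']
    have key := ih (E i j hij.1 (-entry g i j) * g) (by
      have : (Finset.univ.filter fun x : Fin n × Fin n => x.1 < x.2 ∧
          entry (E i j hij.1 (-entry g i j) * g) x.1 x.2 ≠ 0) =
        (Finset.univ.filter fun x : Fin n × Fin n => x.1 < x.2 ∧ entry g x.1 x.2 ≠ 0).erase (i, j) := by
        ext ⟨a, b⟩
        simp only [Finset.mem_filter, Finset.mem_univ, true_and, Finset.mem_erase, entry_E_mul, hrow,
          ne_eq, Prod.mk.injEq]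
        by_cases h1 : i = a <;> by_cases h2 : j = b
        · subst h1 h2; simp
        · subst h1; simp [h2, Ne.symm h2, eq_comm]
        · simp [h1, Ne.symm h1]
        · simp [h1, Ne.symm h1]
      rw [this, Finset.card_erase_of_mem (by simpa using hij), hg]; rfl)
    rw [hψ, hE, zero_add] at key
    exact key

theorem hom_class {n p : ℕ} [NeZero p] (χ : ↥(Uni n p) → ZMod p)
    (hχ : ∀ g h, χ (g * h) = χ g + χ h) :
    ∃ c : ℕ → ZMod p, ∀ g, χ g = ∑ i ∈ Finset.range (n - 1), c i * sd i g := by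
  let c : ℕ → ZMod p := fun i => if hi : i + 1 < n then
    χ (E ⟨i, Nat.lt_of_succ_lt hi⟩ ⟨i + 1, hi⟩ (by simp) 1) else 0
  refine ⟨c, fun g => ?_⟩
  let ψ : ↥(Uni n p) → ZMod p := fun g => χ g - ∑ i ∈ Finset.range (n - 1), c i * sd i g
  have hψ : ∀ g h, ψ (g * h) = ψ g + ψ h := by
    intro g h
    simp only [ψ, hχ, sd_mul, mul_add, Finset.sum_add_distrib]; ring
  have hE1 : ∀ i (hi : i + 1 < n), ψ (E ⟨i, Nat.lt_of_succ_lt hi⟩ ⟨i + 1, hi⟩ (by simp) 1) = 0 := by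
    intro i hi
    simp only [ψ]
    rw [Finset.sum_eq_single_of_mem i (by simp; omega)]
    · simp [c, sd, hi, entry_E]
    · intro k hk hki
      have : k + 1 < n := by simp at hk; omega
      simp [sd, this, entry_E, Ne.symm hki]
  have h1 : ψ 1 = 0 := by simpa using hψ 1 1
  have hEt : ∀ i (hi : i + 1 < n) (m : ℕ), ψ (E ⟨i, Nat.lt_of_succ_lt hi⟩ ⟨i + 1, hi⟩ (by simp) (m : ZMod p)) = 0 := by
    intro i hi m
    induction m with
    | zero =>
      have := hψ (E ⟨i, Nat.lt_of_succ_lt hi⟩ ⟨i + 1, hi⟩ (by simp) (0 : ZMod p)) (E ⟨i, Nat.lt_of_succ_lt hi⟩ ⟨i + 1, hi⟩ (by simp) (0 : ZMod p))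
      rw [← E_add, add_zero] at this
      simpa using this
    | succ m ih => rw [Nat.cast_succ, E_add, hψ, ih, hE1, add_zero]
  have hE : ∀ i j h t, ψ (E i j h t) = 0 := by
    rintro ⟨i, hi⟩ ⟨j, hj⟩ h t
    rcases Nat.lt_or_ge (i + 1) j with h' | h'
    · have := congrArg ψ (E_comm ⟨i, hi⟩ ⟨i + 1, by omega⟩ ⟨j, hj⟩ (by simp) (by simpa using h') t)
      simp only [hψ] at this
      linear_combination -this
    · have : j = i + 1 := by simp at h; omega
      subst this
      have := hEt i hj t.val
      rwa [ZMod.natCast_zmod_val] at this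
  have := gen ψ hψ hE _ g rfl
  simp only [ψ] at this
  linear_combination this

theorem uni_pgroup {n p : ℕ} [Fact p.Prime] [NeZero p] (hn : 0 < n) : IsPGroup p ↥(Uni n p) := by
  intro g
  refine ⟨n, ?_⟩
  haveI : Nonempty (Fin n) := ⟨⟨0, hn⟩⟩
  let M : Matrix (Fin n) (Fin n) (ZMod p) := ((g : (Matrix (Fin n) (Fin n) (ZMod p))ˣ) : Matrix (Fin n) (Fin n) (ZMod p))
  have hM : (M - 1) ^ n = 0 := by
    have h1 : M.charpoly = (Polynomial.X - Polynomial.C 1) ^ n := by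
      rw [Matrix.charpoly_of_isUpperTriangular M (fun i j h => g.2.2 i j h)]
      have : ∀ i, M i i = 1 := g.2.1
      simp [this]
    have h2 := Matrix.aeval_self_charpoly M
    rw [h1] at h2
    simpa using h2
  have h3 : (M - 1) ^ (p ^ n) = 0 := by
    have : n ≤ p ^ n := (Nat.lt_pow_self (Fact.out : p.Prime).one_lt).le
    exact pow_eq_zero_of_le this hM
  rw [sub_pow_char_pow_of_commute _ _ (Commute.one_right M), one_pow, sub_eq_zero] at h3
  apply Subtype.ext; apply Units.ext
  simpa using h3

end S14

namespace S14

theorem zp_nat {M : Type*} [Monoid M] {p : ℕ} [NeZero p] {z : M} (hz : z ^ p = 1) (m : ℕ) :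
    z ^ (m : ZMod p).val = z ^ m := by
  rw [ZMod.val_natCast]
  conv_rhs => rw [← Nat.mod_add_div m p, pow_add, pow_mul, hz, one_pow, mul_one]

theorem zp_add {M : Type*} [Monoid M] {p : ℕ} [NeZero p] {z : M} (hz : z ^ p = 1) (a b : ZMod p) :
    z ^ (a + b).val = z ^ a.val * z ^ b.val := by
  rw [← pow_add, ← zp_nat hz (a.val + b.val)]
  simp

theorem zp_mul {M : Type*} [Monoid M] {p : ℕ} [NeZero p] {z : M} (hz : z ^ p = 1) (a b : ZMod p) :
    z ^ (a * b).val = (z ^ a.val) ^ b.val := by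
  rw [← pow_mul, ← zp_nat hz (a.val * b.val)]
  simp

theorem zp_sum {M : Type*} [CommMonoid M] {p : ℕ} [NeZero p] {z : M} (hz : z ^ p = 1)
    {ι : Type*} (s : Finset ι) (f : ι → ZMod p) :
    z ^ (∑ i ∈ s, f i).val = ∏ i ∈ s, z ^ (f i).val := by
  classical
  induction s using Finset.induction_on with
  | empty => simp
  | insert a s ha ih => rw [Finset.sum_insert ha, Finset.prod_insert ha, zp_add hz, ih]

theorem zp_inj {M : Type*} [CommMonoid M] {p : ℕ} [NeZero p] {z : M} (hz : IsPrimitiveRoot z p)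
    {a b : ZMod p} (h : z ^ a.val = z ^ b.val) : a = b :=
  ZMod.val_injective p (hz.pow_inj (ZMod.val_lt a) (ZMod.val_lt b) h)

theorem exists_log {L : Type*} [Field L] {p : ℕ} [NeZero p] {z : L} (hz : IsPrimitiveRoot z p)
    {x y : L} (hx : x ≠ 0) (h : y ^ p = x ^ p) : ∃ c : ZMod p, y = z ^ c.val * x := by
  have h1 : (y / x) ^ p = 1 := by rw [div_pow, h, div_self (pow_ne_zero _ hx)]
  obtain ⟨i, hi, h2⟩ := hz.eq_pow_of_pow_eq_one h1
  refine ⟨(i : ZMod p), ?_⟩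
  rw [zp_nat hz.pow_eq_one, h2, div_mul_cancel₀ _ hx]

/-- Homs of the wreath type group. -/
def wrCongr {G H : Type*} [Group G] [Group H] (p : ℕ) (e : G ≃* H) : WrG G p ≃* WrG H p where
  toFun x := ⟨fun k => x.base (e.symm k), e x.top⟩
  invFun x := ⟨fun k => x.base (e k), e.symm x.top⟩
  left_inv x := by cases x; simp
  right_inv x := by cases x; simp
  map_mul' x y := by
    show WrG.mk _ _ = WrG.mk _ _
    simp only [WrG.mk.injEq]
    constructor
    · funext k
      show x.base (e.symm k) + y.base (x.top⁻¹ * e.symm k) =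
        x.base (e.symm k) + y.base (e.symm ((e x.top)⁻¹ * k))
      simp
    · exact map_mul e _ _

section tower

variable {F K L : Type} [Field F] [Field K] [Field L] [Algebra F K] [Algebra F L] [Algebra K L]
  [IsScalarTower F K L] [FiniteDimensional F K] [FiniteDimensional F L]
  [IsGalois F K] [IsGalois F L]

theorem wreath (p : ℕ) [Fact p.Prime] [NeZero p] (ζ : F) (hζ : IsPrimitiveRoot ζ p)
    (w : K) (hw0 : w ≠ 0) (x : (K ≃ₐ[F] K) → L)
    (hx : ∀ σ, x σ ^ p = algebraMap K L (σ w))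
    (hgen : ∀ γ : L ≃ₐ[F] L, (∀ k, γ (algebraMap K L k) = algebraMap K L k) →
      (∀ σ, γ (x σ) = x σ) → γ = 1)
    (hindep : ∀ f : (K ≃ₐ[F] K) → ZMod p, (∃ y : K, y ^ p = ∏ σ, (σ w) ^ (f σ).val) → f = 0) :
    Nonempty ((L ≃ₐ[F] L) ≃* WrG (K ≃ₐ[F] K) p) := by
  classical
  have hz : IsPrimitiveRoot (algebraMap F L ζ) p := hζ.map_of_injective (algebraMap F L).injective
  set z := algebraMap F L ζ with hzdef
  have hγz : ∀ (γ : L ≃ₐ[F] L), γ z = z := fun γ => γ.commutes ζ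
  have hx0 : ∀ σ, x σ ≠ 0 := by
    intro σ h
    have := hx σ
    rw [h, zero_pow (NeZero.ne p)] at this
    have h2 := (map_eq_zero (algebraMap K L)).1 this.symm
    exact hw0 (by simpa using h2)
  let r : (L ≃ₐ[F] L) →* (K ≃ₐ[F] K) := AlgEquiv.restrictNormalHom K
  have hr : ∀ γ k, γ (algebraMap K L k) = algebraMap K L (r γ k) := fun γ k =>
    (AlgEquiv.restrictNormal_commutes γ K k).symm
  have hex : ∀ (γ : L ≃ₐ[F] L) (k : K ≃ₐ[F] K), ∃ c : ZMod p,
      γ (x ((r γ)⁻¹ * k)) = z ^ c.val * x k := by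
    intro γ k
    apply exists_log hz (hx0 k)
    rw [← map_pow, hx, hx, hr]
    congr 1
    rw [← AlgEquiv.mul_apply, mul_inv_cancel_left]
  choose c hc using hex
  let Φ : (L ≃ₐ[F] L) →* WrG (K ≃ₐ[F] K) p := MonoidHom.mk' (fun γ => ⟨c γ, r γ⟩) (by
    intro γ δ
    show WrG.mk _ _ = WrG.mk _ _
    simp only [WrG.mk.injEq]
    refine ⟨?_, map_mul r γ δ⟩
    funext k
    show c (γ * δ) k = c γ k + c δ ((r γ)⁻¹ * k)
    apply zp_inj hz
    apply mul_right_cancel₀ (hx0 k)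
    rw [← hc, map_mul, mul_inv_rev, mul_assoc, AlgEquiv.mul_apply, hc, map_mul, map_pow, hγz, hc,
      zp_add hz.pow_eq_one]
    ring)
  refine ⟨MulEquiv.ofBijective Φ ⟨?_, ?_⟩⟩
  · rw [injective_iff_map_eq_one]
    intro γ hγ
    have h1 : c γ = 0 := congrArg WrG.base hγ
    have h2 : r γ = 1 := congrArg WrG.top hγ
    apply hgen
    · intro k; rw [hr, h2]; rfl
    · intro σ
      have := hc γ σ
      rw [h2, h1] at this
      simpa using this
  · -- the image of the kernel
    let A : AddSubgroup ((K ≃ₐ[F] K) → ZMod p) :=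
      { carrier := {f | ∃ γ, r γ = 1 ∧ c γ = f}
        zero_mem' := ⟨1, map_one r, by
          have : Φ 1 = 1 := map_one Φ
          exact congrArg WrG.base this⟩
        add_mem' := by
          rintro _ _ ⟨γ, h1, rfl⟩ ⟨δ, h2, rfl⟩
          refine ⟨γ * δ, by rw [map_mul, h1, h2, one_mul], ?_⟩
          have : (Φ (γ * δ)).base = (Φ γ * Φ δ).base := by rw [map_mul]
          change c (γ * δ) = c γ + (fun k => c δ ((r γ)⁻¹ * k)) at this
          rw [this, h1]; simp
        neg_mem' := by
          rintro _ ⟨γ, h1, rfl⟩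
          refine ⟨γ⁻¹, by rw [map_inv, h1, inv_one], ?_⟩
          have : (Φ (γ⁻¹)).base = ((Φ γ)⁻¹).base := by rw [map_inv]
          change c (γ⁻¹) = (fun k => - c γ (r γ * k)) at this
          rw [this, h1]; funext k; simp }
    let V : Submodule (ZMod p) ((K ≃ₐ[F] K) → ZMod p) := AddSubgroup.toZModSubmodule p A
    have hV : V = ⊤ := by
      by_contra hne
      obtain ⟨φ, hφ0, hφ⟩ := Submodule.exists_le_ker_of_lt_top V (lt_top_iff_ne_top.2 hne)
      let f : (K ≃ₐ[F] K) → ZMod p := fun σ => φ (Pi.single σ 1)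
      have hφf : ∀ g, φ g = ∑ σ, g σ * f σ := by
        intro g
        conv_lhs => rw [pi_eq_sum_univ' g]
        simp [f, map_sum]
      have hf : f = 0 := by
        apply hindep
        have hgal : IsGalois K L := IsGalois.tower_top_of_isGalois F K L
        have hfd : FiniteDimensional K L := FiniteDimensional.right F K L
        have : (∏ σ, x σ ^ (f σ).val) ∈ Set.range (algebraMap K L) := by
          rw [IsGalois.mem_range_algebraMap_iff_fixed]
          intro γ'
          let γ : L ≃ₐ[F] L := γ'.restrictScalars F
          have h1 : r γ = 1 := by
            ext k
            apply (algebraMap K L).injective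
            rw [← hr]
            exact γ'.commutes k
          have h2 : ∀ σ, γ' (x σ) = z ^ (c γ σ).val * x σ := by
            intro σ
            have := hc γ σ
            rw [h1, inv_one, one_mul] at this
            exact this
          have h3 : φ (c γ) = 0 := hφ (show c γ ∈ A from ⟨γ, h1, rfl⟩)
          rw [hφf] at h3
          rw [map_prod]
          simp only [map_pow, h2, mul_pow, Finset.prod_mul_distrib]
          simp only [← zp_mul hz.pow_eq_one]
          rw [← zp_sum hz.pow_eq_one, h3]
          simp
        obtain ⟨y, hy⟩ := this
        refine ⟨y, ?_⟩
        apply (algebraMap K L).injective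
        rw [map_pow, hy, map_prod, ← Finset.prod_pow]
        refine Finset.prod_congr rfl fun σ _ => ?_
        rw [map_pow, ← hx, ← pow_mul, ← pow_mul, mul_comm]
      apply hφ0
      ext g
      simp [hφf, hf]
    rintro ⟨g, s⟩
    obtain ⟨γ, hγ⟩ := AlgEquiv.restrictNormalHom_surjective (F := F) (K₁ := K) L s
    have hmem : (g - c γ) ∈ V := by rw [hV]; trivial
    obtain ⟨δ, h1, h2⟩ := hmem
    refine ⟨δ * γ, ?_⟩
    rw [map_mul]
    show WrG.mk (c δ + fun k => c γ ((r δ)⁻¹ * k)) (r δ * r γ) = WrG.mk _ _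
    rw [h1, h2, show r γ = s from hγ]
    simp

end tower

section indep

variable {F K : Type} [Field F] [Field K] [Algebra F K] [FiniteDimensional F K] [IsGalois F K]

theorem indep_of_norm (p : ℕ) [Fact p.Prime] [NeZero p] (hG : IsPGroup p (K ≃ₐ[F] K))
    (w : K) (hw0 : w ≠ 0)
    (hN : ¬ ∃ y : K, y ^ p = algebraMap F K (Algebra.norm F w))
    (f : (K ≃ₐ[F] K) → ZMod p) (hf : ∃ y : K, y ^ p = ∏ σ, (σ w) ^ (f σ).val) : f = 0 := by
  classical
  have hσ0 : ∀ σ : K ≃ₐ[F] K, σ w ≠ 0 := fun σ => by simpa using hw0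
  let M : AddSubmonoid ((K ≃ₐ[F] K) → ZMod p) :=
    { carrier := {f | ∃ y : K, y ^ p = ∏ σ, (σ w) ^ (f σ).val}
      zero_mem' := ⟨1, by simp⟩
      add_mem' := by
        rintro f g ⟨y, hy⟩ ⟨y', hy'⟩
        refine ⟨y * y' / ∏ σ : K ≃ₐ[F] K, (σ w) ^ (((f σ).val + (g σ).val) / p), ?_⟩
        rw [div_pow, mul_pow, hy, hy', ← Finset.prod_mul_distrib, ← Finset.prod_pow,
          ← Finset.prod_div_distrib]
        refine Finset.prod_congr rfl fun σ _ => ?_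
        rw [div_eq_iff (pow_ne_zero _ (pow_ne_zero _ (hσ0 σ))), ← pow_mul, ← pow_add, ← pow_add,
          Pi.add_apply, ZMod.val_add, mul_comm _ p, Nat.mod_add_div] }
  let A : AddSubgroup ((K ≃ₐ[F] K) → ZMod p) :=
    { M with
      neg_mem' := by
        intro f hf
        have h1 : (p - 1) • f ∈ M := AddSubmonoid.nsmul_mem M hf _
        have h2 : -f = (p - 1) • f := by
          have h3 : (p - 1) • f + f = p • f := by
            rw [← succ_nsmul, Nat.sub_add_cancel (Nat.pos_of_ne_zero (NeZero.ne p))]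
          have h4 : p • f = 0 := by ext σ; simp
          rw [h4] at h3
          exact (eq_neg_of_add_eq_zero_left h3).symm
        rw [h2]; exact h1 }
  by_contra hne
  have hfA : f ∈ A := hf
  letI : MulAction (K ≃ₐ[F] K) A :=
    { smul := fun g f => ⟨fun k => f.1 (g⁻¹ * k), by
        obtain ⟨y, hy⟩ := f.2
        refine ⟨g y, ?_⟩
        rw [← map_pow, hy, map_prod]
        refine Fintype.prod_equiv (Equiv.mulLeft g) _ _ fun σ => ?_
        simp [AlgEquiv.mul_apply]⟩
      one_smul := by
        intro f; apply Subtype.ext; funext k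
        show f.1 (1⁻¹ * k) = f.1 k
        simp
      mul_smul := by
        intro g h f; apply Subtype.ext; funext k
        show f.1 ((g * h)⁻¹ * k) = f.1 (h⁻¹ * (g⁻¹ * k))
        simp [mul_assoc] }
  have hcard : p ∣ Nat.card A := by
    have h1 : addOrderOf (⟨f, hfA⟩ : A) = p := by
      apply addOrderOf_eq_prime
      · apply Subtype.ext; ext σ; simp
      · intro h; exact hne (congrArg Subtype.val h)
    exact h1.symm.dvd.trans (addOrderOf_dvd_natCard _)
  obtain ⟨b, hb, hb0⟩ := hG.exists_fixed_point_of_prime_dvd_card_of_fixed_point A hcard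
    (a := (0 : A)) (by intro g; rfl)
  have hconst : ∀ k, b.1 k = b.1 1 := by
    intro k
    have := congrFun (congrArg Subtype.val (hb k)) k
    change b.1 (k⁻¹ * k) = b.1 k at this
    rw [← this, inv_mul_cancel]
  have hb1 : b.1 1 ≠ 0 := by
    intro h
    apply hb0
    apply Subtype.ext
    funext k
    rw [hconst, h]; rfl
  have h1 : (((b.1 1)⁻¹ : ZMod p).val) • b.1 ∈ A := AddSubgroup.nsmul_mem A b.2 _
  have h2 : (((b.1 1)⁻¹ : ZMod p).val) • b.1 = fun _ => 1 := by
    funext k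
    simp [hconst k, hb1]
  rw [h2] at h1
  obtain ⟨y, hy⟩ := h1
  apply hN
  refine ⟨y, ?_⟩
  have : Fact (1 < p) := ⟨(Fact.out : p.Prime).one_lt⟩
  rw [hy, Algebra.norm_eq_prod_automorphisms]
  simp [ZMod.val_one]

end indep

end S14

namespace S14

theorem not_pow (p n : ℕ) [Fact p.Prime] [NeZero p] (hn : 2 ≤ n)
    {F K : Type} [Field F] [Field K] [Algebra F K] [FiniteDimensional F K] [IsGalois F K]
    (ζ : F) (hζ : IsPrimitiveRoot ζ p)
    (e : (K ≃ₐ[F] K) ≃* ↥(Uni n p))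
    (a : ℕ → F) (ha : ∀ i, i < n → a i ≠ 0)
    (α : ℕ → K)
    (hcompat : ∀ i : ℕ, ∀ hi : i + 1 < n,
      α i ^ p = algebraMap F K (a i) ∧
      ∀ σ : K ≃ₐ[F] K,
        σ (α i) = algebraMap F K ζ ^
            (entry (e σ) ⟨i, Nat.lt_of_succ_lt hi⟩ ⟨i + 1, hi⟩).val * α i)
    (hind : ∀ eexp : ℕ → ℕ, (∀ i, i < n → eexp i < p) → (∃ i, i < n ∧ eexp i ≠ 0) →
      ¬∃ y : F, y ^ p = ∏ i ∈ Finset.range n, a i ^ eexp i) :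
    ¬ ∃ y : K, y ^ p = algebraMap F K (a (n - 1)) := by
  rintro ⟨y, hy⟩
  have hz : IsPrimitiveRoot (algebraMap F K ζ) p := hζ.map_of_injective (algebraMap F K).injective
  set z := algebraMap F K ζ with hzdef
  have hσz : ∀ σ : K ≃ₐ[F] K, σ z = z := fun σ => σ.commutes ζ
  have hy0 : y ≠ 0 := by
    rintro rfl
    rw [zero_pow (NeZero.ne p)] at hy
    exact ha (n - 1) (by omega) ((map_eq_zero _).1 hy.symm)
  have hex : ∀ σ : K ≃ₐ[F] K, ∃ c : ZMod p, σ y = z ^ c.val * y := fun σ =>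
    exists_log hz hy0 (by rw [← map_pow, hy, AlgEquiv.commutes])
  choose c hc using hex
  have hcm : ∀ σ τ, c (σ * τ) = c σ + c τ := by
    intro σ τ
    apply zp_inj hz
    apply mul_right_cancel₀ hy0
    rw [← hc, AlgEquiv.mul_apply, hc, map_mul, map_pow, hσz, hc, zp_add hz.pow_eq_one]
    ring
  obtain ⟨d, hd⟩ := hom_class (fun g => c (e.symm g)) (by intro g h; simp [hcm])
  have hd' : ∀ σ, c σ = ∑ i ∈ Finset.range (n - 1), d i * sd i (e σ) := by
    intro σ; simpa using hd (e σ)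
  have hfix : (y * ∏ i ∈ Finset.range (n - 1), α i ^ (-d i).val) ∈ Set.range (algebraMap F K) := by
    rw [IsGalois.mem_range_algebraMap_iff_fixed]
    intro σ
    have h1 : ∀ i ∈ Finset.range (n - 1), σ (α i ^ (-d i).val) =
        z ^ (-(d i * sd i (e σ))).val * α i ^ (-d i).val := by
      intro i hi
      have hi' : i + 1 < n := by simp at hi; omega
      rw [map_pow, (hcompat i hi').2 σ, mul_pow, ← zp_mul hz.pow_eq_one]
      simp only [sd, hi', dif_pos]
      congr 3
      ring
    rw [map_mul, map_prod, Finset.prod_congr rfl h1, Finset.prod_mul_distrib, hc,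
      ← zp_sum hz.pow_eq_one, hd']
    have h2 : z ^ (∑ i ∈ Finset.range (n - 1), d i * sd i (e σ)).val *
        z ^ (∑ i ∈ Finset.range (n - 1), -(d i * sd i (e σ))).val = 1 := by
      rw [← zp_add hz.pow_eq_one]; simp
    linear_combination (y * ∏ i ∈ Finset.range (n - 1), α i ^ (-d i).val) * h2
  obtain ⟨u, hu⟩ := hfix
  have hp1 : 1 < p := (Fact.out : p.Prime).one_lt
  refine hind (fun i => if i = n - 1 then 1 else (-d i).val) ?_ ⟨n - 1, by omega, by simp⟩ ⟨u, ?_⟩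
  · intro i _
    split_ifs
    · exact hp1
    · exact ZMod.val_lt _
  · apply (algebraMap F K).injective
    obtain ⟨m, rfl⟩ : ∃ m, n = m + 1 := ⟨n - 1, by omega⟩
    rw [map_pow, hu, mul_pow, hy, Finset.prod_range_succ, map_mul, mul_comm, map_prod,
      ← Finset.prod_pow]
    simp only [Nat.add_sub_cancel, if_true, pow_one]
    congr 1
    refine Finset.prod_congr rfl fun i hi => ?_
    have hi' : i < m := by simpa using hi
    rw [if_neg hi'.ne, map_pow, ← (hcompat i (by omega)).1, ← pow_mul, ← pow_mul, mul_comm]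

end S14

set_option maxHeartbeats 1000000 in
/-- Let `p` be a prime, `n ≥ 2`, `F` a field with a primitive `p`-th root of unity `ζ` and
algebraic closure `Ω`, and `K/F` a finite Galois extension inside `Ω` equipped with an
isomorphism `e : Gal(K/F) ≅ U_n(F_p)` compatible with `a 0, …, a (n−2) ∈ F^×`. Let
`a (n-1) ∈ F^×` be a norm from `K`, say `N_{K/F}(w) = a (n-1)` with `w ∈ K^×`, and assume
`a 0, …, a (n-1)` are linearly independent in `F^×/(F^×)^p`. If `L` is the subfield of `Ω`
generated over `K` by all `p`-th roots of the conjugates `σ(w)`, `σ ∈ Gal(K/F)`, then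
`L/F` is a finite Galois extension and `Gal(L/F) ≅ F_p[U_n(F_p)] ⋊ U_n(F_p)`, the
semidirect product for the left-translation action of `U_n(F_p)` on functions
`U_n(F_p) → F_p`. -/
theorem stmt_14 (p n : ℕ) [Fact p.Prime] [NeZero p] (hn : 2 ≤ n)
    (F Ω : Type) [Field F] [Field Ω] [Algebra F Ω] [IsAlgClosure F Ω]
    (ζ : F) (hζ : IsPrimitiveRoot ζ p)
    (K : IntermediateField F Ω) [FiniteDimensional F K] [IsGalois F K]
    (e : (↥K ≃ₐ[F] ↥K) ≃* ↥(Uni n p))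
    (a : ℕ → F) (ha : ∀ i, i < n → a i ≠ 0)
    (α : ℕ → ↥K)
    (hcompat : ∀ i : ℕ, ∀ hi : i + 1 < n,
      α i ^ p = algebraMap F ↥K (a i) ∧
      ∀ σ : ↥K ≃ₐ[F] ↥K,
        σ (α i) = algebraMap F ↥K ζ ^
            (entry (e σ) ⟨i, by omega⟩ ⟨i + 1, hi⟩).val * α i)
    (w : ↥K) (hw0 : w ≠ 0) (hw : Algebra.norm F w = a (n - 1))
    (hind : ∀ eexp : ℕ → ℕ, (∀ i, i < n → eexp i < p) → (∃ i, i < n ∧ eexp i ≠ 0) →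
      ¬∃ y : F, y ^ p = ∏ i ∈ Finset.range n, a i ^ eexp i)
    (L : IntermediateField F Ω)
    (hL : L = IntermediateField.adjoin F
      ((K : Set Ω) ∪
        {x : Ω | ∃ σ : ↥K ≃ₐ[F] ↥K, x ^ p = algebraMap (↥K) Ω (σ w)})) :
    FiniteDimensional F L ∧ IsGalois F L ∧
      Nonempty ((↥L ≃ₐ[F] ↥L) ≃* WrG (↥(Uni n p)) p) := by
  classical
  have hpp : p.Prime := Fact.out
  have : Algebra.IsAlgebraic F Ω := IsAlgClosure.isAlgebraic
  have : IsAlgClosed Ω := IsAlgClosure.isAlgClosed F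
  have : Normal F Ω := IsAlgClosure.normal F Ω
  have hpF : (p : F) ≠ 0 := by
    have := hζ.neZero'
    exact NeZero.ne _
  have hz : IsPrimitiveRoot (algebraMap F Ω ζ) p := hζ.map_of_injective (algebraMap F Ω).injective
  have hσ0 : ∀ σ : ↥K ≃ₐ[F] ↥K, σ w ≠ 0 := fun σ => by simpa using hw0
  have hKL : K ≤ L := by
    intro k hk
    rw [hL]
    exact subset_adjoin F _ (Or.inl hk)
  have hxL : ∀ x : Ω, ∀ σ : ↥K ≃ₐ[F] ↥K, x ^ p = algebraMap (↥K) Ω (σ w) → x ∈ L := by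
    intro x σ hx
    rw [hL]
    exact subset_adjoin F _ (Or.inr ⟨σ, hx⟩)
  have hroot : ∀ σ : ↥K ≃ₐ[F] ↥K, ∃ x : Ω, x ^ p = algebraMap (↥K) Ω (σ w) := fun σ =>
    IsAlgClosed.exists_pow_nat_eq _ hpp.pos
  choose x0 hx0 using hroot
  have hx00 : ∀ σ, x0 σ ≠ 0 := by
    intro σ h
    have := hx0 σ
    rw [h, zero_pow (NeZero.ne p)] at this
    exact hσ0 σ ((map_eq_zero (algebraMap K Ω)).1 this.symm)
  -- finiteness
  have hfin : FiniteDimensional F L := by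
    have h1 : L = K ⊔ adjoin F (Set.range x0) := by
      apply le_antisymm
      · rw [hL, adjoin_le_iff]
        rintro x (hx | ⟨σ, hx⟩)
        · exact (le_sup_left : K ≤ _) hx
        · obtain ⟨c, hc⟩ := S14.exists_log hz (hx00 σ) (hx.trans (hx0 σ).symm)
          rw [hc]
          refine mul_mem (pow_mem (IntermediateField.algebraMap_mem _ _) _) ?_
          exact (le_sup_right : adjoin F (Set.range x0) ≤ _) (subset_adjoin F _ ⟨σ, rfl⟩)
      · refine sup_le hKL ?_
        rw [adjoin_le_iff]
        rintro _ ⟨σ, rfl⟩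
        exact hxL _ σ (hx0 σ)
    have h2 : FiniteDimensional F (adjoin F (Set.range x0)) :=
      finiteDimensional_adjoin fun x _ => (Algebra.IsAlgebraic.isAlgebraic x).isIntegral
    rw [h1]
    infer_instance
  have hsep : Algebra.IsSeparable F L := by
    rw [hL, isSeparable_adjoin_iff_isSeparable]
    rintro x (hx | ⟨σ, hx⟩)
    · have hK : Algebra.IsSeparable F K := inferInstance
      exact mem_separableClosure_iff.1 ((le_separableClosure_iff F Ω K).2 hK hx)
    · have h1 : IsSeparable K x := by
        have hpK : (p : K) ≠ 0 := by
          have := (map_ne_zero (algebraMap F K)).2 hpF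
          simpa using this
        have h2 := Polynomial.separable_X_pow_sub_C (σ w) hpK (hσ0 σ)
        refine h2.of_dvd (minpoly.dvd K x ?_)
        simp [hx]
      exact IsSeparable.of_algebra_isSeparable_of_isSeparable F h1
  have hnor : Normal F L := by
    rw [normal_iff_forall_map_le']
    intro τ
    have hτK : ∀ k : K, τ k = algebraMap K Ω ((τ.restrictNormal K) k) := fun k =>
      (AlgEquiv.restrictNormal_commutes τ K k).symm
    conv_lhs => rw [hL]
    rw [adjoin_map, adjoin_le_iff]
    rintro _ ⟨x, hx | ⟨σ, hx⟩, rfl⟩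
    · apply hKL
      have := hτK ⟨x, hx⟩
      change τ x = _ at this
      change τ x ∈ K
      rw [this]
      exact Subtype.property _
    · apply hxL _ (τ.restrictNormal K * σ)
      change (τ x) ^ p = _
      rw [← map_pow, hx]
      exact hτK _
  have hgal : IsGalois F L := ⟨⟩
  refine ⟨hfin, hgal, ?_⟩
  letI : Algebra K L := (inclusion hKL).toAlgebra
  have : IsScalarTower F K L := IsScalarTower.of_algebraMap_eq fun _ => rfl
  have hmap : ∀ k : K, ((algebraMap K L k : L) : Ω) = k := fun _ => rfl
  have hG : IsPGroup p (↥K ≃ₐ[F] ↥K) :=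
    (S14.uni_pgroup (by omega)).of_equiv e.symm
  have hnp := S14.not_pow p n hn ζ hζ e a ha α hcompat hind
  rw [← hw] at hnp
  obtain ⟨Φ⟩ := S14.wreath (F := F) (K := K) (L := L) p ζ hζ w hw0
    (fun σ => ⟨x0 σ, hxL _ σ (hx0 σ)⟩)
    (fun σ => Subtype.ext (hx0 σ))
    (by
      intro γ h1 h2
      have : L.val.comp (γ : L →ₐ[F] L) = L.val := by
        apply algHom_ext_of_eq_adjoin F hL
        rintro x (hx | ⟨σ, hx⟩)
        · exact congrArg L.val (h1 ⟨x, hx⟩)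
        · obtain ⟨c, hc⟩ := S14.exists_log hz (hx00 σ) (hx.trans (hx0 σ).symm)
          have h3 : (⟨x, hxL x σ hx⟩ : L) = algebraMap F L ζ ^ c.val * ⟨x0 σ, hxL _ σ (hx0 σ)⟩ :=
            Subtype.ext hc
          change L.val (γ ⟨x, hxL x σ hx⟩) = L.val ⟨x, hxL x σ hx⟩
          rw [h3, map_mul, map_pow, AlgEquiv.commutes, h2]
      ext y
      exact DFunLike.congr_fun this y)
    (S14.indep_of_norm p hG w hw0 hnp)
  exact ⟨Φ.trans (S14.wrCongr p e)⟩
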